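/- arXiv:0804.4399 — 2 statements merged into one kernel-verified Lean document; each statement's English description precedes it below -/
import Mathlib

section
/- Let γ be a core subgraph of a multigraph Γ. Then Γ is core if and only if the contraction Γ//γ is core. (Hence the class of core graphs is closed under extension.) -/
open scoped Classical

/-- A multigraph: finite sets of vertices and edges, where each edge is
assigned an unordered pair of (possibly equal) endpoints. -/
structure Multigraph where
  V : Type
  E : Type
  finV : Finite V
  finE : Finite E
  ends : E → Sym2 V

attribute [instance] Multigraph.finV Multigraph.finE

namespace Multigraph

variable (G : Multigraph)

/-- `v` and `w` are joined by some edge belonging to `μ`. -/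
def Step (μ : Set G.E) (v w : G.V) : Prop :=
  ∃ e ∈ μ, G.ends e = s(v, w)

/-- Connectivity with respect to the edge set `μ`, as a setoid on all vertices. -/
def connSetoid (μ : Set G.E) : Setoid G.V :=
  Relation.EqvGen.setoid (G.Step μ)

/-- The number of connected components of the spanning subgraph `(V(G), μ)`. -/
noncomputable def h0 (μ : Set G.E) : ℕ :=
  Nat.card (Quotient (G.connSetoid μ))

/-- The first Betti number `h1 = |E| − |V| + h0` of the subgraph with edge set `μ`.
(Isolated vertices contribute equally to `|V|` and to `h0`, so this agrees with
the first Betti number of the subgraph whose vertices are the endpoints of the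
edges in `μ`.) -/
noncomputable def h1 (μ : Set G.E) : ℤ :=
  (Nat.card μ : ℤ) - (Nat.card G.V : ℤ) + (G.h0 μ : ℤ)

/-- A subgraph (identified with its edge set) is core (1PI): removing any one of
its edges lowers `h1`. -/
def IsCore (μ : Set G.E) : Prop :=
  ∀ e ∈ μ, G.h1 (μ \ {e}) < G.h1 μ

/-- The multigraph is connected. -/
def Connected : Prop := G.h0 Set.univ = 1

/-- The contraction `Γ//γ`: each connected component of `γ` is contracted to a
single vertex and the edges of `γ` are deleted. -/
def contract (γ : Set G.E) : Multigraph where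
  V := Quotient (G.connSetoid γ)
  E := {e : G.E // e ∉ γ}
  finV := Quotient.finite _
  finE := Subtype.finite
  ends e := (G.ends e.1).map (Quotient.mk (G.connSetoid γ))

/-- The subgraph with edge set `γ`, as a multigraph in its own right. -/
def restrict (γ : Set G.E) : Multigraph where
  V := G.V
  E := γ
  finV := G.finV
  finE := Subtype.finite
  ends e := G.ends e.1

/-- `F` is a spanning forest: it is acyclic and consists of one spanning tree of
each connected component (equivalently, it induces the same connectivity
relation as the full edge set). -/
def IsSpanningForest (F : Set G.E) : Prop :=
  G.h1 F = 0 ∧ G.connSetoid F = G.connSetoid Set.univ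

/-- The first Kirchhoff–Symanzik (graph) polynomial
`ψ(Γ) = Σ_F Π_{e ∉ F} A_e`, the sum over spanning forests. -/
noncomputable def kirchhoff : MvPolynomial G.E ℤ :=
  ∑ᶠ F ∈ {F : Set G.E | G.IsSpanningForest F}, ∏ᶠ e ∈ Fᶜ, MvPolynomial.X e

/-- Euclidean dot product on `ℝ^D`. -/
noncomputable def dot {D : ℕ} (x y : Fin D → ℝ) : ℝ := ∑ i, x i * y i

/-- The total momentum entering the connected component `c` of `(V(G), F)`. -/
noncomputable def momentumOf {D : ℕ} (q : G.V → Fin D → ℝ) (F : Set G.E)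
    (c : Quotient (G.connSetoid F)) : Fin D → ℝ :=
  ∑ᶠ v ∈ {v : G.V | Quotient.mk (G.connSetoid F) v = c}, q v

/-- The second Kirchhoff–Symanzik polynomial
`φ(Γ) = Σ_{(T₁,T₂)} (Q(T₁)·Q(T₂)) Π_{e ∉ T₁∪T₂} A_e`, the sum over spanning
2-forests, i.e. acyclic edge sets `F` with exactly two connected components
`T₁, T₂` (jointly covering all vertices); `Q(T_i)` is the sum of the momenta
over the vertices of `T_i`, and `Q(T₁)·Q(T₂)` is computed symmetrically via
`Q(T₁)·Q(T₂) = ((Q(T₁)+Q(T₂))² − Q(T₁)² − Q(T₂)²)/2`. -/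
noncomputable def symanzik2 (D : ℕ) (q : G.V → Fin D → ℝ) : MvPolynomial G.E ℝ :=
  ∑ᶠ F ∈ {F : Set G.E | G.h1 F = 0 ∧ G.h0 F = 2},
    MvPolynomial.C
      ((dot (∑ᶠ v, q v) (∑ᶠ v, q v) -
          ∑ᶠ c : Quotient (G.connSetoid F), dot (G.momentumOf q F c) (G.momentumOf q F c)) / 2) *
      ∏ᶠ e ∈ Fᶜ, MvPolynomial.X e

/-- External momenta pass to the contraction `Γ//γ` by assigning to each vertex
(i.e. each connected component of `γ`, or untouched vertex) the sum of the
momenta of the vertices identified to it. -/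
noncomputable def contractMomenta (γ : Set G.E) {D : ℕ} (q : G.V → Fin D → ℝ) :
    (G.contract γ).V → Fin D → ℝ :=
  fun c => ∑ᶠ v ∈ {v : G.V | Quotient.mk (G.connSetoid γ) v = c}, q v

/-- A flag of core subgraphs of the subgraph `γ`: a chain (under inclusion) of
nonempty core subgraphs of `γ`, having `γ` itself as its largest member.  We
encode a flag as its set of members. -/
def IsCoreFlagIn (γ : Set G.E) (F : Set (Set G.E)) : Prop :=
  γ ∈ F ∧ ∅ ∉ F ∧ (∀ δ ∈ F, δ ⊆ γ ∧ G.IsCore δ) ∧ IsChain (· ⊆ ·) F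

/-- A maximal flag of core subgraphs of `γ`: one admitting no refinement. -/
def IsMaximalCoreFlagIn (γ : Set G.E) (F : Set (Set G.E)) : Prop :=
  G.IsCoreFlagIn γ F ∧ ∀ F' : Set (Set G.E), G.IsCoreFlagIn γ F' → F ⊆ F' → F' = F

/-- A flag of core subgraphs of `Γ`. -/
def IsCoreFlag (F : Set (Set G.E)) : Prop := G.IsCoreFlagIn Set.univ F

/-- A maximal flag of core subgraphs of `Γ`. -/
def IsMaximalCoreFlag (F : Set (Set G.E)) : Prop := G.IsMaximalCoreFlagIn Set.univ F

end Multigraph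

namespace Multigraph

variable {G : Multigraph}

theorem connSetoid_le_iff {μ : Set G.E} {s : Setoid G.V} :
    G.connSetoid μ ≤ s ↔ ∀ e ∈ μ, ∀ v w, G.ends e = s(v, w) → s v w := by
  constructor
  · intro h e he v w hvw
    exact h (Relation.EqvGen.rel _ _ ⟨e, he, hvw⟩)
  · intro h v w hvw
    induction hvw with
    | rel x y hxy =>
      obtain ⟨e, he, hxy⟩ := hxy
      exact h e he x y hxy
    | refl x => exact s.refl x
    | symm x y _ ih => exact s.symm ih
    | trans x y z _ _ ih₁ ih₂ => exact s.trans ih₁ ih₂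

theorem connSetoid_of_mem {μ : Set G.E} {e : G.E} (he : e ∈ μ) {v w : G.V}
    (h : G.ends e = s(v, w)) : G.connSetoid μ v w :=
  Relation.EqvGen.rel _ _ ⟨e, he, h⟩

theorem connSetoid_mono {μ ν : Set G.E} (h : μ ⊆ ν) : G.connSetoid μ ≤ G.connSetoid ν :=
  connSetoid_le_iff.2 fun _ he _ _ hvw => connSetoid_of_mem (h he) hvw

/-- Nested edge sets have nested connectivity relations; the smaller one has no more
components than the larger one iff these relations agree. -/
theorem h0_le_h0_iff {μ ν : Set G.E} (h : μ ⊆ ν) :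
    G.h0 μ ≤ G.h0 ν ↔ G.connSetoid ν ≤ G.connSetoid μ := by
  let f : Quotient (G.connSetoid μ) → Quotient (G.connSetoid ν) :=
    Quotient.map' id fun _ _ hxy => connSetoid_mono h hxy
  have hf : Function.Surjective f := by
    rintro ⟨v⟩
    exact ⟨Quotient.mk _ v, rfl⟩
  constructor
  · intro hle v w hvw
    have hcard : Nat.card (Quotient (G.connSetoid μ)) = Nat.card (Quotient (G.connSetoid ν)) :=
      le_antisymm hle (Nat.card_le_card_of_surjective f hf)
    have hinj := ((Nat.bijective_iff_surjective_and_card f).2 ⟨hf, hcard⟩).injective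
    have heq : f (Quotient.mk _ v) = f (Quotient.mk _ w) := Quotient.sound hvw
    exact Quotient.exact (hinj heq)
  · intro hle
    rw [h0, h0, le_antisymm hle (connSetoid_mono h)]

/-- A subgraph is core iff it has no bridge: the endpoints of each of its edges stay connected
after removal of that edge. -/
theorem isCore_iff {μ : Set G.E} :
    G.IsCore μ ↔
      ∀ e ∈ μ, ∀ v w, G.ends e = s(v, w) → G.connSetoid (μ \ {e}) v w := by
  refine forall₂_congr fun e he => ?_
  have hcard : Nat.card ↥(μ \ {e}) + 1 = Nat.card μ := by
    simpa only [Nat.card_coe_set_eq] using Set.ncard_sdiff_singleton_add_one he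
  have hlt : G.h1 (μ \ {e}) < G.h1 μ ↔ G.h0 (μ \ {e}) ≤ G.h0 μ := by
    unfold h1
    omega
  rw [hlt, h0_le_h0_iff Set.sdiff_subset, connSetoid_le_iff]
  refine ⟨fun h => h e he, fun h e' he' v w hvw => ?_⟩
  by_cases hee : e' = e
  · subst hee
    exact h v w hvw
  · exact connSetoid_of_mem (show e' ∈ μ \ {e} from ⟨he', hee⟩) hvw

/-- The projection of the vertices of `Γ` onto those of `Γ//γ`. -/
def contractMk (γ : Set G.E) (v : G.V) : (G.contract γ).V :=
  Quotient.mk (G.connSetoid γ) v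

/-- The edges of `Γ//γ` viewed as edges of `Γ`. -/
def contractVal (γ : Set G.E) (e : (G.contract γ).E) : G.E :=
  e.1

theorem contractMk_eq_iff {γ : Set G.E} {v w : G.V} :
    contractMk γ v = contractMk γ w ↔ G.connSetoid γ v w :=
  Quotient.eq

theorem contract_ends {γ : Set G.E} {e : (G.contract γ).E} {v w : G.V}
    (h : G.ends (contractVal γ e) = s(v, w)) :
    (G.contract γ).ends e = s(contractMk γ v, contractMk γ w) :=
  congrArg (Sym2.map (contractMk γ)) h

theorem exists_ends_of_contract_ends {γ : Set G.E} {e : (G.contract γ).E}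
    {x y : (G.contract γ).V} (h : (G.contract γ).ends e = s(x, y)) :
    ∃ v w, G.ends (contractVal γ e) = s(v, w) ∧ contractMk γ v = x ∧ contractMk γ w = y := by
  induction hab : G.ends (contractVal γ e) with | _ a b
  rw [contract_ends hab, Sym2.eq_iff] at h
  obtain ⟨hx, hy⟩ | ⟨hy, hx⟩ := h
  · exact ⟨a, b, rfl, hx, hy⟩
  · exact ⟨b, a, Sym2.eq_swap, hx, hy⟩

/-- Connectivity in the contraction `Γ//γ` by `δ` is connectivity in `Γ` by `γ ∪ δ`. -/
theorem contract_connSetoid_mk_iff {γ : Set G.E} {δ : Set (G.contract γ).E} {v w : G.V} :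
    (G.contract γ).connSetoid δ (contractMk γ v) (contractMk γ w) ↔
      G.connSetoid (γ ∪ contractVal γ '' δ) v w := by
  have hγ : G.connSetoid γ ≤ G.connSetoid (γ ∪ contractVal γ '' δ) :=
    connSetoid_mono Set.subset_union_left
  constructor
  · let f : (G.contract γ).V → Quotient (G.connSetoid (γ ∪ contractVal γ '' δ)) :=
      Quotient.map' id fun _ _ hxy => hγ hxy
    have hle : (G.contract γ).connSetoid δ ≤ Setoid.ker f := by
      refine connSetoid_le_iff.2 fun e he x y hxy => ?_
      obtain ⟨a, b, hab, rfl, rfl⟩ := exists_ends_of_contract_ends hxy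
      exact Quotient.sound (connSetoid_of_mem (Or.inr ⟨e, he, rfl⟩) hab)
    exact fun h => Quotient.exact (hle h)
  · have hle : G.connSetoid (γ ∪ contractVal γ '' δ) ≤
        ((G.contract γ).connSetoid δ).comap (contractMk γ) := by
      refine connSetoid_le_iff.2 fun e he x y hxy => ?_
      rw [Setoid.comap_rel]
      obtain he | ⟨e, he, rfl⟩ := he
      · rw [contractMk_eq_iff.2 (connSetoid_of_mem he hxy)]
      · exact connSetoid_of_mem he (contract_ends hxy)
    exact fun h => hle h

theorem union_image_contractVal_univ_diff_singleton {γ : Set G.E} (e : (G.contract γ).E) :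
    γ ∪ contractVal γ '' (Set.univ \ {e}) = Set.univ \ {contractVal γ e} := by
  ext x
  constructor
  · rintro (hx | ⟨y, hy, rfl⟩)
    · refine ⟨trivial, ?_⟩
      rintro rfl
      exact e.2 hx
    · exact ⟨trivial, fun h => hy.2 (Subtype.ext h)⟩
  · rintro ⟨-, hx⟩
    by_cases hxγ : x ∈ γ
    · exact Or.inl hxγ
    · refine Or.inr ⟨⟨x, hxγ⟩, ⟨trivial, ?_⟩, rfl⟩
      rintro rfl
      exact hx rfl

/-- Removing an edge outside `γ` disconnects two vertices in `Γ` iff it disconnects their images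
in `Γ//γ`. -/
theorem contract_connSetoid_univ_diff_singleton_iff {γ : Set G.E} {e : (G.contract γ).E}
    {v w : G.V} :
    (G.contract γ).connSetoid (Set.univ \ {e}) (contractMk γ v) (contractMk γ w) ↔
      G.connSetoid (Set.univ \ {contractVal γ e}) v w := by
  rw [contract_connSetoid_mk_iff, union_image_contractVal_univ_diff_singleton]

end Multigraph

open Multigraph in
/-- for a core subgraph `γ` of `Γ`, `Γ` is core iff `Γ//γ` is core. -/
theorem isCore_iff_contract_isCore (G : Multigraph) (γ : Set G.E) (hγ : G.IsCore γ) :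
    G.IsCore Set.univ ↔ (G.contract γ).IsCore Set.univ := by
  rw [isCore_iff] at hγ
  rw [isCore_iff, isCore_iff]
  constructor
  · intro h e _ x y hxy
    obtain ⟨v, w, hvw, rfl, rfl⟩ := exists_ends_of_contract_ends hxy
    exact contract_connSetoid_univ_diff_singleton_iff.2 (h _ trivial v w hvw)
  · intro h e _ v w hvw
    by_cases he : e ∈ γ
    · exact connSetoid_mono (Set.sdiff_subset_sdiff_left (Set.subset_univ γ)) (hγ e he v w hvw)
    · let e' : (G.contract γ).E := ⟨e, he⟩
      have hvw' : G.ends (contractVal γ e') = s(v, w) := hvw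
      exact contract_connSetoid_univ_diff_singleton_iff.1
        (h e' trivial _ _ (contract_ends hvw'))
end

section
/- The exponential integral E₁(z) := ∫_1^∞ e^{−tz} t^{−1} dt, defined for real z > 0, satisfies E₁(z) = −γ − log z + O(z) as z → 0⁺; that is, there exist constants C > 0 and δ > 0 such that |E₁(z) + γ + log z| ≤ C·z for all 0 < z ≤ δ, where γ is the Euler–Mascheroni constant. -/
open MeasureTheory Set Filter Topology in
theorem integral_log_mul_exp_neg :
    ∫ t in Ioi (0 : ℝ), Real.log t * Real.exp (-t) = -Real.eulerMascheroniConstant := by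
  have h := Complex.hasDerivAt_GammaIntegral (s := 1) (by simp)
  have hG : Complex.Gamma =ᶠ[𝓝 1] Complex.GammaIntegral := by
    filter_upwards [(isOpen_lt continuous_const Complex.continuous_re).mem_nhds
      (show (1 : ℂ) ∈ {s : ℂ | 0 < s.re} by simp)] with s hs
    exact Complex.Gamma_eq_integral hs
  have hu := (h.congr_of_eventuallyEq hG).unique Complex.hasDerivAt_Gamma_one
  rw [← Complex.ofReal_inj, ← integral_complex_ofReal, Complex.ofReal_neg, ← hu]
  refine setIntegral_congr_fun measurableSet_Ioi fun t _ => ?_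
  simp

open MeasureTheory Set in
theorem integrableOn_log_mul_exp_neg :
    IntegrableOn (fun t : ℝ => Real.log t * Real.exp (-t)) (Ioi 0) := by
  refine Integrable.of_integral_ne_zero ?_
  rw [integral_log_mul_exp_neg]
  linarith [Real.one_half_lt_eulerMascheroniConstant]

open MeasureTheory Set in
theorem integrableOn_exp_neg_div {z : ℝ} (hz : 0 < z) :
    IntegrableOn (fun t : ℝ => Real.exp (-t) / t) (Ioi z) := by
  refine Integrable.mono' ((integrableOn_exp_neg_Ioi z).const_mul z⁻¹)
    (Measurable.aestronglyMeasurable (by fun_prop)) ?_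
  filter_upwards [ae_restrict_mem measurableSet_Ioi] with t ht
  have ht' : z < t := ht
  rw [Real.norm_of_nonneg (by have := hz.trans ht'; positivity), div_eq_inv_mul]
  gcongr

open MeasureTheory Set Filter Topology in
/-- Integration by parts on the tail. -/
theorem integral_exp_neg_div_Ioi {z : ℝ} (hz : 0 < z) :
    ∫ t in Ioi z, Real.exp (-t) / t =
      (∫ t in Ioi z, Real.log t * Real.exp (-t)) - Real.log z * Real.exp (-z) := by
  have hlog := integrableOn_log_mul_exp_neg.mono_set (Ioi_subset_Ioi hz.le)
  have hdiv := integrableOn_exp_neg_div hz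
  have hder : ∀ t ∈ Ici z, HasDerivAt (fun t => Real.log t * Real.exp (-t))
      (Real.exp (-t) / t - Real.log t * Real.exp (-t)) t := fun t ht => by
    have ht0 : t ≠ 0 := (hz.trans_le ht).ne'
    refine ((Real.hasDerivAt_log ht0).mul (hasDerivAt_neg t).exp).congr_deriv ?_
    ring
  have hlim : Tendsto (fun t => Real.log t * Real.exp (-t)) atTop (𝓝 0) := by
    refine squeeze_zero' ?_ ?_ (Real.tendsto_pow_mul_exp_neg_atTop_nhds_zero 1)
    · filter_upwards [eventually_ge_atTop 1] with t ht
      have := Real.log_nonneg ht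
      positivity
    · filter_upwards [eventually_ge_atTop 1] with t ht
      rw [pow_one]
      gcongr
      exact Real.log_le_self (by linarith)
  have h := integral_Ioi_of_hasDerivAt_of_tendsto' hder (hdiv.sub hlog) hlim
  rw [integral_sub hdiv hlog] at h
  linarith

theorem one_sub_exp_neg_div_mem_Icc {t : ℝ} (ht : 0 ≤ t) :
    (1 - Real.exp (-t)) / t ∈ Set.Icc (0 : ℝ) 1 := by
  have h1 := Real.add_one_le_exp (-t)
  have h2 : Real.exp (-t) ≤ 1 := Real.exp_le_one_iff.2 (by linarith)
  exact ⟨div_nonneg (by linarith) ht, div_le_one_of_le₀ (by linarith) ht⟩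

open MeasureTheory Set in
theorem intervalIntegrable_one_sub_exp_neg_div {z : ℝ} (hz : 0 ≤ z) :
    IntervalIntegrable (fun t : ℝ => (1 - Real.exp (-t)) / t) volume 0 z := by
  refine (intervalIntegrable_const (c := (1 : ℝ))).mono_fun (Measurable.aestronglyMeasurable (by fun_prop)) ?_
  rw [uIoc_of_le hz]
  filter_upwards [ae_restrict_mem measurableSet_Ioc] with t ht
  obtain ⟨h0, h1⟩ := one_sub_exp_neg_div_mem_Icc ht.1.le
  rwa [Real.norm_of_nonneg h0, norm_one]

open MeasureTheory Set Filter Topology in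
theorem continuousOn_one_sub_exp_neg_mul_log :
    ContinuousOn (fun t : ℝ => (1 - Real.exp (-t)) * Real.log t) (Ici 0) := by
  intro t ht
  rcases (show (0 : ℝ) ≤ t from ht).eq_or_lt with rfl | ht
  · have hlim : Tendsto (fun t : ℝ => |t * Real.log t|) (𝓝[Ici 0] 0) (𝓝 0) := by
      have := (Real.continuous_mul_log.abs.tendsto 0).mono_left
        (nhdsWithin_le_nhds (s := Ici (0 : ℝ)))
      simpa using this
    rw [ContinuousWithinAt, Real.log_zero, mul_zero]
    refine squeeze_zero_norm' ?_ hlim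
    filter_upwards [self_mem_nhdsWithin] with t ht
    have ht : 0 ≤ t := ht
    have h1 := Real.add_one_le_exp (-t)
    have h2 : Real.exp (-t) ≤ 1 := Real.exp_le_one_iff.2 (by linarith)
    rw [Real.norm_eq_abs, abs_mul, abs_mul, abs_of_nonneg ht,
      abs_of_nonneg (show 0 ≤ 1 - Real.exp (-t) by linarith)]
    gcongr
    linarith
  · exact ContinuousAt.continuousWithinAt (by fun_prop (disch := exact ht.ne'))

open MeasureTheory Set in
/-- Integration by parts near the origin. -/
theorem integral_log_mul_exp_neg_zero {z : ℝ} (hz : 0 ≤ z) :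
    ∫ t in (0 : ℝ)..z, Real.log t * Real.exp (-t) =
      (1 - Real.exp (-z)) * Real.log z - ∫ t in (0 : ℝ)..z, (1 - Real.exp (-t)) / t := by
  have hlog : IntervalIntegrable (fun t : ℝ => Real.log t * Real.exp (-t)) volume 0 z :=
    (intervalIntegrable_iff_integrableOn_Ioc_of_le hz).2
      (integrableOn_log_mul_exp_neg.mono_set Ioc_subset_Ioi_self)
  have hdiv := intervalIntegrable_one_sub_exp_neg_div hz
  have hder : ∀ t ∈ Ioo 0 z, HasDerivAt (fun t => (1 - Real.exp (-t)) * Real.log t)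
      (Real.log t * Real.exp (-t) + (1 - Real.exp (-t)) / t) t := fun t ht => by
    refine (((hasDerivAt_neg t).exp.const_sub 1).mul
      (Real.hasDerivAt_log ht.1.ne')).congr_deriv ?_
    ring
  have h := intervalIntegral.integral_eq_sub_of_hasDerivAt_of_le hz
    (continuousOn_one_sub_exp_neg_mul_log.mono Icc_subset_Ici_self) hder (hlog.add hdiv)
  rw [intervalIntegral.integral_add hlog hdiv] at h
  simp only [Real.log_zero, mul_zero, sub_zero] at h
  linarith

open MeasureTheory Set in
theorem integral_exp_neg_mul_div {z : ℝ} (hz : 0 < z) :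
    ∫ t in Ioi (1 : ℝ), Real.exp (-(t * z)) / t = ∫ t in Ioi z, Real.exp (-t) / t := by
  have h := integral_comp_mul_right_Ioi (fun u => Real.exp (-u) / u) 1 hz
  rw [one_mul, smul_eq_mul, eq_inv_mul_iff_mul_eq₀ hz.ne', ← integral_const_mul] at h
  rw [← h]
  refine setIntegral_congr_fun measurableSet_Ioi fun t _ => ?_
  field_simp

open MeasureTheory Set in
theorem exponentialIntegral_add_eulerMascheroniConstant_add_log {z : ℝ} (hz : 0 < z) :
    (∫ t in Ioi (1 : ℝ), Real.exp (-(t * z)) / t) +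
        Real.eulerMascheroniConstant + Real.log z =
      ∫ t in (0 : ℝ)..z, (1 - Real.exp (-t)) / t := by
  have hsplit := intervalIntegral.integral_interval_add_Ioi integrableOn_log_mul_exp_neg
    (integrableOn_log_mul_exp_neg.mono_set (Ioi_subset_Ioi hz.le))
  rw [integral_log_mul_exp_neg, integral_log_mul_exp_neg_zero hz.le] at hsplit
  rw [integral_exp_neg_mul_div hz, integral_exp_neg_div_Ioi hz]
  linarith

/-- the exponential integral `E₁(z) = ∫_1^∞ e^{−tz} dt/t`
satisfies `E₁(z) = −γ − log z + O(z)` as `z → 0⁺`, where `γ` is the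
Euler–Mascheroni constant: there are `C > 0` and `δ > 0` with
`|E₁(z) + γ + log z| ≤ C·z` for all `0 < z ≤ δ`. -/
theorem exponentialIntegral_asymptotic :
    ∃ C > (0 : ℝ), ∃ δ > (0 : ℝ), ∀ z : ℝ, 0 < z → z ≤ δ →
      |(∫ t in Set.Ioi (1 : ℝ), Real.exp (-(t * z)) / t) +
          Real.eulerMascheroniConstant + Real.log z| ≤ C * z := by
  refine ⟨1, one_pos, 1, one_pos, fun z hz _ => ?_⟩
  rw [exponentialIntegral_add_eulerMascheroniConstant_add_log hz, ← Real.norm_eq_abs]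
  convert intervalIntegral.norm_integral_le_of_norm_le_const (C := 1) (a := 0) (b := z)
    (f := fun t : ℝ => (1 - Real.exp (-t)) / t) fun t ht => ?_ using 2
  · rw [sub_zero, abs_of_pos hz]
  · rw [Set.uIoc_of_le hz.le] at ht
    obtain ⟨h0, h1⟩ := one_sub_exp_neg_div_mem_Icc ht.1.le
    rwa [Real.norm_of_nonneg h0]
end
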